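/- arXiv:2310.11123 — 7 statements merged into one kernel-verified Lean document; each statement's English description precedes it below -/
import Mathlib

section
/- Let B be a finite skew brace of nilpotent type (i.e. the additive group (B,+) is nilpotent) such that b∗b = 0 for all b ∈ B. Then B is centrally nilpotent. -/
/-- A (left) skew brace: a set with two group structures `(B,+)` and `(B,·)`
satisfying `a · (b + c) = a · b - a + a · c`. -/
class SkewBrace (B : Type*) extends AddGroup B, Group B where
  skew : ∀ a b c : B, a * (b + c) = a * b - a + a * c

/-- The star product of a skew brace: `a ∗ b = -a + a·b - b`. -/
def sstar {B : Type*} [SkewBrace B] (a b : B) : B := -a + a * b - b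

/-- The upper central series of a skew brace, defined elementwise:
`zeta B 0 = {0}` and `x ∈ zeta B (n+1)` iff the image of `x` in the quotient
`B / zeta B n` lies in `ζ(B/zeta B n) = Soc(B/zeta B n) ∩ Z(B/zeta B n, ·)`,
i.e. iff for all `b`, `x·b ≡ x + b` (so `x` is in the kernel of the `λ`-map of
the quotient), `x + b ≡ b + x` and `x·b ≡ b·x` modulo `zeta B n`. -/
def zeta (B : Type*) [SkewBrace B] : ℕ → Set B
  | 0 => {0}
  | n + 1 =>
    {x | ∀ b : B,
      -(x * b) + (x + b) ∈ zeta B n ∧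
      -(x + b) + (b + x) ∈ zeta B n ∧
      (x * b)⁻¹ * (b * x) ∈ zeta B n}

/-- A skew brace is centrally nilpotent if its upper central series reaches `B`
after finitely many steps. -/
def CentrallyNilpotent (B : Type*) [SkewBrace B] : Prop :=
  ∃ n : ℕ, zeta B n = Set.univ

namespace SkewBrace

section Lambda

variable {B : Type*} [SkewBrace B]

theorem mul_zero_eq (a : B) : a * 0 = a := by
  have h := skew a 0 0
  rw [add_zero, sub_eq_add_neg, add_assoc, left_eq_add, neg_add_eq_zero] at h
  exact h.symm

theorem zero_eq_one : (0 : B) = 1 := by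
  simpa using mul_zero_eq (1 : B)

/-- The `λ`-map of a skew brace. -/
def lam (a b : B) : B := -a + a * b

theorem mul_eq_add_lam (a b : B) : a * b = a + lam a b := by
  simp [lam]

theorem lam_add (a b c : B) : lam a (b + c) = lam a b + lam a c := by
  simp only [lam, skew, sub_eq_add_neg, add_assoc]

theorem lam_zero (a : B) : lam a 0 = 0 := by
  simp [lam, mul_zero_eq]

theorem lam_mul (a b c : B) : lam (a * b) c = lam a (lam b c) := by
  have h : a * (b * c) = a * b + lam a (lam b c) := by
    rw [mul_eq_add_lam b c, mul_eq_add_lam a, lam_add, ← add_assoc, ← mul_eq_add_lam a b]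
  rw [lam, mul_assoc, h, neg_add_cancel_left]

theorem lam_one (b : B) : lam 1 b = b := by
  rw [lam, one_mul, ← zero_eq_one, neg_zero, zero_add]

theorem lam_lam_inv (a b : B) : lam a (lam a⁻¹ b) = b := by
  rw [← lam_mul, mul_inv_cancel, lam_one]

theorem lam_inv_lam (a b : B) : lam a⁻¹ (lam a b) = b := by
  rw [← lam_mul, inv_mul_cancel, lam_one]

/-- The `λ`-map of an element as an additive endomorphism. -/
def lamHom (a : B) : B →+ B where
  toFun := lam a
  map_zero' := lam_zero a
  map_add' := lam_add a

theorem lam_nsmul (a b : B) (n : ℕ) : lam a (n • b) = n • lam a b :=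
  map_nsmul (lamHom a) n b

theorem lam_zsmul (a b : B) (n : ℤ) : lam a (n • b) = n • lam a b :=
  map_zsmul (lamHom a) n b

theorem lam_mem_center {x : B} (hx : x ∈ AddSubgroup.center B) (a : B) :
    lam a x ∈ AddSubgroup.center B := by
  rw [AddSubgroup.mem_center_iff] at hx ⊢
  intro g
  rw [← lam_lam_inv a g, ← lam_add, ← lam_add, hx]

theorem lam_self {b : B} (hb : sstar b b = 0) : lam b b = b := by
  rwa [sstar, sub_eq_zero] at hb

theorem pow_eq_nsmul {b : B} (hb : sstar b b = 0) (n : ℕ) : b ^ n = n • b := by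
  induction n with
  | zero => simp [zero_eq_one]
  | succ n ih => rw [pow_succ', ih, mul_eq_add_lam, lam_nsmul, lam_self hb, succ_nsmul']

end Lambda

section Center

variable {B : Type*} [SkewBrace B]

theorem mem_zeta_succ {n : ℕ} {x : B} :
    x ∈ zeta B (n + 1) ↔ ∀ b : B,
      -(x * b) + (x + b) ∈ zeta B n ∧
      -(x + b) + (b + x) ∈ zeta B n ∧
      (x * b)⁻¹ * (b * x) ∈ zeta B n :=
  Iff.rfl

theorem mem_zeta_zero {x : B} : x ∈ zeta B 0 ↔ x = 0 :=
  Iff.rfl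

theorem mem_zeta_one {x : B} :
    x ∈ zeta B 1 ↔ ∀ b : B, x * b = x + b ∧ x + b = b + x ∧ x * b = b * x := by
  have h1 (a b : B) : -a + b = 0 ↔ a = b := neg_add_eq_zero
  have h2 (a b : B) : a⁻¹ * b = 0 ↔ a = b := by rw [zero_eq_one, inv_mul_eq_one]
  simp only [mem_zeta_succ, mem_zeta_zero, h1, h2]

theorem zero_mem_zeta_one : (0 : B) ∈ zeta B 1 := by
  rw [mem_zeta_one]
  intro b
  have h : (0 : B) * b = b := by rw [zero_eq_one, one_mul]
  simp [h, mul_zero_eq]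

theorem add_mem_zeta_one {x y : B} (hx : x ∈ zeta B 1) (hy : y ∈ zeta B 1) :
    x + y ∈ zeta B 1 := by
  rw [mem_zeta_one] at *
  intro b
  have h1 : (x + y) * b = x + y + b := by
    rw [← (hx y).1, mul_assoc, (hy b).1, (hx _).1, (hx y).1, add_assoc]
  refine ⟨h1, ?_, ?_⟩
  · rw [add_assoc, (hy b).2.1, ← add_assoc, (hx b).2.1, add_assoc]
  · rw [← (hx y).1, mul_assoc, (hy b).2.2, ← mul_assoc, (hx b).2.2, mul_assoc]

theorem neg_mem_zeta_one {x : B} (hx : x ∈ zeta B 1) : -x ∈ zeta B 1 := by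
  rw [mem_zeta_one] at *
  have hinv : -x = x⁻¹ := by
    rw [eq_inv_iff_mul_eq_one, ← (hx _).2.2, (hx _).1, add_neg_cancel, zero_eq_one]
  intro b
  refine ⟨?_, ?_, ?_⟩
  · rw [hinv, inv_mul_eq_iff_eq_mul, (hx _).1, ← hinv, add_neg_cancel_left]
  · rw [neg_add_eq_iff_eq_add, ← add_assoc, (hx b).2.1, add_neg_cancel_right]
  · rw [hinv, inv_mul_eq_iff_eq_mul, ← mul_assoc, (hx b).2.2, mul_inv_cancel_right]

/-- The additive congruence whose classes are the cosets of `zeta B 1`. -/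
def zetaAddCon (B : Type*) [SkewBrace B] : AddCon B where
  r x y := ∃ i ∈ zeta B 1, y = i + x
  iseqv :=
    { refl x := ⟨0, zero_mem_zeta_one, (zero_add x).symm⟩
      symm := by
        rintro x _ ⟨i, hi, rfl⟩
        exact ⟨-i, neg_mem_zeta_one hi, (neg_add_cancel_left i x).symm⟩
      trans := by
        rintro x _ _ ⟨i, hi, rfl⟩ ⟨j, hj, rfl⟩
        exact ⟨j + i, add_mem_zeta_one hj hi, (add_assoc j i x).symm⟩ }
  add' := by
    rintro x _ y _ ⟨i, hi, rfl⟩ ⟨j, hj, rfl⟩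
    refine ⟨i + j, add_mem_zeta_one hi hj, ?_⟩
    rw [add_assoc, ← add_assoc x, ← (mem_zeta_one.1 hj x).2.1]
    simp only [add_assoc]

/-- The multiplicative congruence whose classes are the cosets of `zeta B 1`. -/
def zetaCon (B : Type*) [SkewBrace B] : Con B where
  toSetoid := (zetaAddCon B).toSetoid
  mul' := by
    rintro x _ y _ ⟨i, hi, rfl⟩ ⟨j, hj, rfl⟩
    refine ⟨i + j, add_mem_zeta_one hi hj, ?_⟩
    rw [mem_zeta_one] at hi hj
    rw [← (hi x).1, ← (hj y).1, mul_assoc, ← mul_assoc x, ← (hj x).2.2, mul_assoc, (hj _).1,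
      (hi _).1, add_assoc]

/-- The quotient of a skew brace by its first centre `zeta B 1`. -/
abbrev ZetaQuotient (B : Type*) [SkewBrace B] : Type _ := (zetaAddCon B).Quotient

instance (B : Type*) [SkewBrace B] : SkewBrace (ZetaQuotient B) :=
  { (inferInstance : AddGroup (zetaAddCon B).Quotient),
    (inferInstance : Group (zetaCon B).Quotient) with
    skew := by
      rintro ⟨a⟩ ⟨b⟩ ⟨c⟩
      exact congrArg (Quotient.mk (zetaAddCon B).toSetoid) (skew a b c) }

/-- The projection of a skew brace to its quotient by `zeta B 1`. -/
def toZetaQuotient (b : B) : ZetaQuotient B := Quotient.mk (zetaAddCon B).toSetoid b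

theorem toZetaQuotient_surjective : Function.Surjective (toZetaQuotient (B := B)) :=
  Quotient.mk_surjective

theorem toZetaQuotient_eq_iff {x y : B} :
    toZetaQuotient x = toZetaQuotient y ↔ ∃ i ∈ zeta B 1, y = i + x :=
  Quotient.eq (r := (zetaAddCon B).toSetoid)

theorem toZetaQuotient_eq_zero_iff {x : B} : toZetaQuotient x = 0 ↔ x ∈ zeta B 1 := by
  rw [eq_comm]
  refine (toZetaQuotient_eq_iff (x := 0)).trans ?_
  simp

theorem mem_zeta_succ_iff (n : ℕ) {x : B} :
    x ∈ zeta B (n + 1) ↔ toZetaQuotient x ∈ zeta (ZetaQuotient B) n := by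
  induction n generalizing x with
  | zero => exact toZetaQuotient_eq_zero_iff.symm
  | succ n ih =>
    rw [mem_zeta_succ, mem_zeta_succ, toZetaQuotient_surjective.forall]
    refine forall_congr' fun b => ?_
    rw [ih, ih, ih]
    rfl

theorem centrallyNilpotent_of_zetaQuotient (h : CentrallyNilpotent (ZetaQuotient B)) :
    CentrallyNilpotent B := by
  obtain ⟨n, hn⟩ := h
  refine ⟨n + 1, Set.eq_univ_of_forall fun x => ?_⟩
  rw [mem_zeta_succ_iff, hn]
  trivial

end Center

section StarSelf

variable {B : Type*} [SkewBrace B]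

theorem mem_zeta_one_of_lam_fixed (hstar : ∀ b : B, sstar b b = 0) {x : B}
    (hx : x ∈ AddSubgroup.center B) (hfix : ∀ b, lam b x = x) : x ∈ zeta B 1 := by
  rw [AddSubgroup.mem_center_iff] at hx
  rw [mem_zeta_one]
  intro b
  have hbx : b * x = b + x := by rw [mul_eq_add_lam, hfix]
  have h1 : lam (b * x) (b + x) = b + x := by
    rw [hbx, lam_self (hstar (b + x))]
  rw [lam_add, hfix, add_left_inj, lam_mul] at h1
  have h2 : lam x b = b := by
    rw [← lam_inv_lam b (lam x b), h1]
    nth_rewrite 2 [← lam_self (hstar b)]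
    rw [lam_inv_lam]
  have h3 : x * b = x + b := by rw [mul_eq_add_lam, h2]
  exact ⟨h3, (hx b).symm, by rw [h3, hbx, hx]⟩

/-- An element fixing the sum of two commuting elements of coprime orders fixes both. -/
theorem lam_eq_of_coprime {m p : ℕ} (hmp : m.Coprime p) {b c x : B} (hcomm : AddCommute b x)
    (hb : m • b = 0) (hx : p • x = 0) (h : lam c (b + x) = b + x) :
    lam c b = b ∧ lam c x = x := by
  have hp : lam c (p • b) = p • b := by
    have := lam_nsmul c (b + x) p
    rwa [h, hcomm.add_nsmul, hx, add_zero] at this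
  obtain ⟨u, v, huv⟩ := Nat.isCoprime_iff_coprime.2 hmp
  have hv : v • (p • b) = b := by
    conv_rhs => rw [← one_zsmul b, ← huv, add_zsmul, mul_zsmul, mul_zsmul, natCast_zsmul,
      natCast_zsmul, hb, zsmul_zero, zero_add]
  have hcb : lam c b = b := by
    rw [← hv, lam_zsmul, hp]
  refine ⟨hcb, ?_⟩
  rwa [lam_add, hcb, add_right_inj] at h

theorem lam_fixes_of_coprime (hstar : ∀ b : B, sstar b b = 0) {m p : ℕ} (hmp : m.Coprime p)
    {b : B} (hb : m • b = 0) {x : B} (hx : x ∈ AddSubgroup.center B) (hpx : p • x = 0) :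
    lam b x = x := by
  have hcomm {y : B} (hy : y ∈ AddSubgroup.center B) : AddCommute b y :=
    AddSubgroup.mem_center_iff.1 hy b
  have hxb : lam x b = b := by
    have hy := lam_mem_center hx b
    have hpy : p • lam b x = 0 := by rw [← lam_nsmul, hpx, lam_zero]
    have h := (lam_eq_of_coprime hmp (hcomm hy) hb hpy (lam_self (hstar (b + lam b x)))).1
    rw [← mul_eq_add_lam, lam_mul] at h
    rw [← lam_inv_lam b (lam x b), h]
    nth_rewrite 2 [← lam_self (hstar b)]
    rw [lam_inv_lam]
  have h := (lam_eq_of_coprime hmp (hcomm hx) hb hpx (lam_self (hstar (b + x)))).2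
  rw [(hcomm hx).eq, ← hxb, ← mul_eq_add_lam, lam_mul] at h
  rw [← lam_inv_lam x (lam b x), h]
  nth_rewrite 2 [← lam_self (hstar x)]
  rw [lam_inv_lam]

/-- The central elements of additive order dividing `p`. -/
def centralTorsion (B : Type*) [SkewBrace B] (p : ℕ) : AddSubgroup B where
  carrier := {x | x ∈ AddSubgroup.center B ∧ p • x = 0}
  zero_mem' := ⟨zero_mem _, smul_zero p⟩
  add_mem' := by
    rintro x y ⟨hx, hpx⟩ ⟨hy, hpy⟩
    have hxy : AddCommute x y := AddSubgroup.mem_center_iff.1 hy x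
    exact ⟨add_mem hx hy, by rw [hxy.add_nsmul, hpx, hpy, add_zero]⟩
  neg_mem' := by
    rintro x ⟨hx, hpx⟩
    exact ⟨neg_mem hx, by rw [neg_nsmul, hpx, neg_zero]⟩

/-- The `λ`-action on the central elements of order dividing `p`. -/
@[reducible]
def centralTorsionAction (B : Type*) [SkewBrace B] (p : ℕ) :
    MulAction B (centralTorsion B p) where
  smul b x := ⟨lam b x, lam_mem_center x.2.1 b, by rw [← lam_nsmul, x.2.2, lam_zero]⟩
  one_smul x := Subtype.ext (lam_one _)
  mul_smul a b x := Subtype.ext (lam_mul a b _)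

theorem exists_ne_zero_mem_zeta_one [Finite B] [Nontrivial B]
    (hnil : Group.IsNilpotent (Multiplicative B)) (hstar : ∀ b : B, sstar b b = 0) :
    ∃ x ∈ zeta B 1, x ≠ 0 := by
  obtain ⟨z, hz, hz0⟩ : ∃ z ∈ AddSubgroup.center B, z ≠ 0 := by
    obtain ⟨z, hz, hz1⟩ := Subgroup.ne_bot_iff_exists_ne_one.1
      (Group.IsNilpotent.center_ne_bot (G := Multiplicative B)) |>.imp fun z h =>
        And.intro z.2 h
    refine ⟨(z : Multiplicative B).toAdd, ?_, fun h => hz1 (Subtype.ext h)⟩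
    exact AddSubgroup.mem_center_iff.2 fun g =>
      Subgroup.mem_center_iff.1 hz (Multiplicative.ofAdd g)
  have hord : addOrderOf z ≠ 1 := by simpa using hz0
  obtain ⟨p, hp, q, hq⟩ := Nat.exists_prime_and_dvd hord
  have : Fact p.Prime := ⟨hp⟩
  have hpx : p • q • z = 0 := by rw [← mul_nsmul', ← hq, addOrderOf_nsmul_eq_zero]
  have hx0 : q • z ≠ 0 := fun h => by
    have hq0 : 0 < q := Nat.pos_of_ne_zero fun h0 =>
      (addOrderOf_pos z).ne' (by rw [hq, h0, mul_zero])
    have h1 := Nat.le_of_dvd hq0 (addOrderOf_dvd_of_nsmul_eq_zero h)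
    rw [hq] at h1
    nlinarith [hp.two_le]
  let x : centralTorsion B p := ⟨q • z, nsmul_mem hz q, hpx⟩
  have hdvd : p ∣ Nat.card (centralTorsion B p) := by
    have h := addOrderOf_dvd_natCard x
    rwa [addOrderOf_eq_prime (p := p) (Subtype.ext hpx)
      fun h => hx0 (congrArg Subtype.val h)] at h
  let := centralTorsionAction B p
  have hG : IsPGroup p (MulAction.toPermHom B (centralTorsion B p)).range := by
    rintro ⟨_, b, rfl⟩
    obtain ⟨k, m, hm, hcard⟩ :=
      Nat.exists_eq_pow_mul_and_not_dvd (Nat.card_pos (α := B)).ne' p hp.ne_one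
    refine ⟨k, Subtype.ext ?_⟩
    change MulAction.toPermHom B (centralTorsion B p) b ^ p ^ k = 1
    rw [← map_pow, pow_eq_nsmul (hstar b)]
    ext y
    refine lam_fixes_of_coprime hstar ((hp.coprime_iff_not_dvd.2 hm).symm) ?_ y.2.1 y.2.2
    rw [← mul_nsmul, ← hcard]
    exact card_nsmul_eq_zero'
  obtain ⟨y, hy, hy0⟩ := hG.exists_fixed_point_of_prime_dvd_card_of_fixed_point _ hdvd
    (a := 0) (by
      rintro ⟨_, b, rfl⟩
      exact Subtype.ext (lam_zero b))
  refine ⟨y, mem_zeta_one_of_lam_fixed hstar y.2.1 fun b => ?_,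
    fun h => hy0 (Subtype.ext h.symm)⟩
  exact congrArg Subtype.val (hy ⟨_, b, rfl⟩)

end StarSelf

end SkewBrace

open SkewBrace in
/-- A finite skew brace of nilpotent type (i.e. whose additive group is
nilpotent) in which `b ∗ b = 0` for all `b` is centrally nilpotent. -/
theorem statement0 (B : Type*) [SkewBrace B] [Fintype B]
    (hnil : Group.IsNilpotent (Multiplicative B))
    (hstar : ∀ b : B, sstar b b = 0) :
    CentrallyNilpotent B := by
  have key (n : ℕ) : ∀ (C : Type _) [SkewBrace C] [Finite C],
      Group.IsNilpotent (Multiplicative C) → (∀ b : C, sstar b b = 0) → Nat.card C = n →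
      CentrallyNilpotent C := by
    induction n using Nat.strong_induction_on with
    | _ n ih =>
      intro C _ _ hC hs hn
      rcases subsingleton_or_nontrivial C with h | h
      · exact ⟨0, Set.eq_univ_of_forall fun x => Subsingleton.elim x 0⟩
      obtain ⟨x, hx, hx0⟩ := exists_ne_zero_mem_zeta_one hC hs
      have hsurj := toZetaQuotient_surjective (B := C)
      have : Finite (ZetaQuotient C) := Finite.of_surjective _ hsurj
      refine centrallyNilpotent_of_zetaQuotient (ih _ ?_ (ZetaQuotient C) ?_ ?_ rfl)
      · rw [← hn]
        refine lt_of_le_of_ne (Nat.card_le_card_of_surjective _ hsurj) fun h => hx0 ?_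
        have hinj := (Nat.bijective_iff_surjective_and_card _).2 ⟨hsurj, h.symm⟩ |>.1
        exact hinj (toZetaQuotient_eq_zero_iff.2 hx)
      · let f : C →+ ZetaQuotient C := AddMonoidHom.mk' toZetaQuotient fun _ _ => rfl
        exact Group.nilpotent_of_surjective (AddMonoidHom.toMultiplicative f) hsurj
      · rw [hsurj.forall]
        exact fun b => congrArg toZetaQuotient (hs b)
  exact key _ B hnil hstar rfl
end

section
/- There exists a skew brace B of order 6 (with additive group isomorphic to the symmetric group Sym(3)) such that b∗b = 0 for all b ∈ B, but B is not right-nilpotent. -/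
/-- `X ∗ Y`: the subgroup of `(B,+)` generated by all `x ∗ y` with
`x ∈ X`, `y ∈ Y`. -/
def starClosure {B : Type*} [SkewBrace B] (X Y : Set B) : AddSubgroup B :=
  AddSubgroup.closure {z | ∃ x ∈ X, ∃ y ∈ Y, z = sstar x y}

/-- The right series of a skew brace: `R 0 = B`, `R (n+1) = R n ∗ B`. -/
def rightSeries (B : Type*) [SkewBrace B] : ℕ → Set B
  | 0 => Set.univ
  | n + 1 => (starClosure (rightSeries B n) Set.univ : AddSubgroup B)

/-- A skew brace is right-nilpotent if its right series reaches `{0}` after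
finitely many steps. -/
def RightNilpotent (B : Type*) [SkewBrace B] : Prop :=
  ∃ n : ℕ, rightSeries B n = ({0} : Set B)

/-- `B` has order `6`, its additive group is isomorphic to `Sym(3)`,
`b ∗ b = 0` for all `b ∈ B`, and `B` is not right-nilpotent. -/
def Statement4Prop (B : Type*) [SkewBrace B] [Fintype B] : Prop :=
  Fintype.card B = 6 ∧
  Nonempty (B ≃+ Additive (Equiv.Perm (Fin 3))) ∧
  (∀ b : B, sstar b b = 0) ∧
  ¬ RightNilpotent B

/-- The almost trivial skew brace on an additive group: the product is the opposite addition. -/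
abbrev SkewBrace.almostTrivial (A : Type*) [AddGroup A] : SkewBrace A where
  mul a b := b + a
  one := 0
  inv a := -a
  mul_assoc a b c := (add_assoc c b a).symm
  one_mul a := add_zero a
  mul_one a := zero_add a
  inv_mul_cancel a := add_neg_cancel a
  skew a b c := show (b + c) + a = (b + a) - a + (c + a) by
    rw [add_sub_cancel_right, add_assoc]

/-- A nonzero element with `x ∗ y = x` for some `y` lies in every term of the right series. -/
theorem not_rightNilpotent_of_sstar_eq_self {B : Type*} [SkewBrace B] {x y : B}
    (hx : x ≠ 0) (hxy : sstar x y = x) : ¬ RightNilpotent B := by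
  rintro ⟨n, hn⟩
  have mem : ∀ m, x ∈ rightSeries B m := by
    intro m
    induction m with
    | zero => exact Set.mem_univ x
    | succ m ih => exact AddSubgroup.subset_closure ⟨x, ih, y, Set.mem_univ y, hxy.symm⟩
  have h := mem n
  rw [hn] at h
  exact hx h

/-- There exists a skew brace of order `6`, with additive group isomorphic to
`Sym(3)`, in which `b ∗ b = 0` for all `b`, that is not right-nilpotent. -/
theorem statement4 :
    ∃ (B : Type) (inst : SkewBrace B) (instF : Fintype B),
      @Statement4Prop B inst instF := by
  refine ⟨Additive (Equiv.Perm (Fin 3)), SkewBrace.almostTrivial _,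
    inferInstanceAs (Fintype (Equiv.Perm (Fin 3))), ?_, ⟨AddEquiv.refl _⟩, fun b => ?_, ?_⟩
  · exact Fintype.card_perm
  · change -b + (b + b) - b = 0
    rw [neg_add_cancel_left, sub_self]
  · let r : Equiv.Perm (Fin 3) := finRotate 3
    let t : Equiv.Perm (Fin 3) := Equiv.swap 0 1
    refine @not_rightNilpotent_of_sstar_eq_self _ (SkewBrace.almostTrivial _)
      (Additive.ofMul r) (Additive.ofMul t) ?_ ?_
    · change r ≠ 1
      decide
    · change r⁻¹ * (t * r) / t = r
      decide
end

section
/- Let B be a nontrivial finite skew brace whose order is a power of a prime p. Then there exists a nonzero element a in the centre Z(B,+) of the additive group such that b∗a = 0 for all b ∈ B. -/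
namespace SkewBrace

variable {B : Type*} [SkewBrace B]

theorem lam_mem_center_s11 (a : B) {z : Multiplicative B}
    (hz : z ∈ Subgroup.center (Multiplicative B)) :
    Multiplicative.ofAdd (lam a z.toAdd) ∈ Subgroup.center (Multiplicative B) := by
  rw [Subgroup.mem_center_iff] at hz ⊢
  intro g
  have h : lam a⁻¹ g.toAdd + z.toAdd = z.toAdd + lam a⁻¹ g.toAdd :=
    congrArg Multiplicative.toAdd (hz (Multiplicative.ofAdd (lam a⁻¹ g.toAdd)))
  have h' := congrArg (lam a) h
  rw [lam_add, lam_add, lam_lam_inv] at h'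
  exact congrArg Multiplicative.ofAdd h'

/-- The `λ`-action of `(B,·)` on the centre of `(B,+)`. -/
abbrev centerAction : MulAction B (Subgroup.center (Multiplicative B)) where
  smul a z := ⟨Multiplicative.ofAdd (lam a z.1.toAdd), lam_mem_center_s11 a z.2⟩
  one_smul z := Subtype.ext (congrArg Multiplicative.ofAdd (lam_one z.1.toAdd))
  mul_smul a b z := Subtype.ext (congrArg Multiplicative.ofAdd (lam_mul a b z.1.toAdd))

end SkewBrace

open SkewBrace in
/-- In a nontrivial finite skew brace of prime power order there is a nonzero
element `a` of the centre of `(B,+)` with `b ∗ a = 0` for all `b`. -/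
theorem statement11 (B : Type*) [SkewBrace B] [Fintype B] [Nontrivial B]
    (p n : ℕ) (hp : p.Prime) (hcard : Fintype.card B = p ^ n) :
    ∃ a : B, a ≠ 0 ∧ (∀ b : B, a + b = b + a) ∧ ∀ b : B, sstar b a = 0 := by
  have : Fact p.Prime := ⟨hp⟩
  have hB : Nat.card B = p ^ n := by rw [Nat.card_eq_fintype_card, hcard]
  have hmul : IsPGroup p B := IsPGroup.of_card hB
  have hadd : IsPGroup p (Multiplicative B) := IsPGroup.of_card (n := n) hB
  have : Nontrivial (Subgroup.center (Multiplicative B)) := hadd.center_nontrivial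
  obtain ⟨k, hk, hZ⟩ := (hadd.to_subgroup (Subgroup.center _)).nontrivial_iff_card.mp this
  let := centerAction (B := B)
  have h1 : (1 : Subgroup.center (Multiplicative B)) ∈
      MulAction.fixedPoints B (Subgroup.center (Multiplicative B)) := fun b =>
    Subtype.ext (congrArg Multiplicative.ofAdd
      (show -b + b * 0 = 0 by rw [mul_zero_eq, neg_add_cancel]))
  obtain ⟨z, hz, hne⟩ := hmul.exists_fixed_point_of_prime_dvd_card_of_fixed_point
    (Subgroup.center (Multiplicative B)) (hZ ▸ dvd_pow_self p hk.ne') h1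
  refine ⟨z.1.toAdd, fun h => hne (Subtype.ext (congrArg Multiplicative.ofAdd h.symm)),
    fun b => ?_, fun b => ?_⟩
  · exact (congrArg Multiplicative.toAdd
      (Subgroup.mem_center_iff.mp z.2 (Multiplicative.ofAdd b))).symm
  · exact sub_eq_zero.mpr (congrArg (fun w => w.1.toAdd) (hz b))
end

section
/- Let B be a skew brace such that x∗x = 0 for all x ∈ B, and let a ∈ Z(B,+) satisfy b∗a = 0 for all b ∈ B. Then b∗(a∗b) = -(a∗b) for every b ∈ B. -/
theorem mul_eq_add_of_sstar_eq_zero {B : Type*} [SkewBrace B] {x y : B}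
    (h : sstar x y = 0) : x * y = x + y := by
  rw [sstar, sub_eq_zero, neg_add_eq_iff_eq_add] at h
  exact h

theorem SkewBrace.mul_zero_right {B : Type*} [SkewBrace B] (x : B) : x * (0 : B) = x := by
  have h := SkewBrace.skew x 0 0
  rw [add_zero, sub_eq_add_neg, add_assoc, left_eq_add, neg_add_eq_zero] at h
  exact h.symm

/-- If `x ∗ x = 0` for all `x`, every element `a` with `b ∗ a = 0` for all `b`
also satisfies `a ∗ b = 0` for all `b`. -/
theorem sstar_eq_zero_of_forall_sstar_eq_zero {B : Type*} [SkewBrace B]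
    (hsq : ∀ x : B, sstar x x = 0) {a : B} (haK : ∀ b : B, sstar b a = 0) (b : B) :
    sstar a b = 0 := by
  have hba : b * a = b + a := mul_eq_add_of_sstar_eq_zero (haK b)
  have hsum : b * a * b = b + a + b := by
    have h := SkewBrace.skew (b * a) b a
    rw [← hba, mul_eq_add_of_sstar_eq_zero (hsq (b * a)),
      mul_eq_add_of_sstar_eq_zero (haK (b * a)), ← add_assoc, sub_add_cancel] at h
    have h' : b * a + b + a = b * a * b + a := by rw [← h, add_assoc, ← hba]
    rw [← add_right_cancel h', hba]
  have hprod : b * (a + b) = b + a + b := by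
    rw [SkewBrace.skew, hba, mul_eq_add_of_sstar_eq_zero (hsq b), ← add_assoc, sub_add_cancel]
  have hab : a * b = a + b := mul_left_cancel (a := b) (by rw [← mul_assoc, hsum, hprod])
  rw [sstar, hab, neg_add_cancel_left, sub_self]

/-- If `x ∗ x = 0` for all `x` in a skew brace `B` and `a` is an element of
the centre of `(B,+)` with `b ∗ a = 0` for all `b`, then
`b ∗ (a ∗ b) = -(a ∗ b)` for every `b`. -/
theorem statement12 (B : Type*) [SkewBrace B]
    (hsq : ∀ x : B, sstar x x = 0)
    (a : B) (haZ : ∀ b : B, a + b = b + a) (haK : ∀ b : B, sstar b a = 0) :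
    ∀ b : B, sstar b (sstar a b) = -(sstar a b) := by
  intro b
  rw [sstar_eq_zero_of_forall_sstar_eq_zero hsq haK b, sstar, SkewBrace.mul_zero_right,
    neg_add_cancel, sub_zero, neg_zero]
end

section
/- Let B be a finite skew brace of nilpotent type (additive group nilpotent) such that the multiplicative group (B,·) is nilpotent. Then for each prime p, the Sylow p-subgroup L_p of (B,+) is a Sylow p-subgroup of (B,·) and an ideal of B, and B is the direct product of its Sylow subbraces: B = ∏_p L_p. -/
/-- A subset of a skew brace is a sub-skew-brace if it is a subgroup of both
`(B,+)` and `(B,·)`. -/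
def IsSubSkewBrace {B : Type*} [SkewBrace B] (S : Set B) : Prop :=
  (0 : B) ∈ S ∧ (∀ a b : B, a ∈ S → b ∈ S → a + b ∈ S) ∧
    (∀ a : B, a ∈ S → -a ∈ S) ∧
    (∀ a b : B, a ∈ S → b ∈ S → a * b ∈ S) ∧ (∀ a : B, a ∈ S → a⁻¹ ∈ S)

/-- A left-ideal of a skew brace is a sub-skew-brace `L` with `B ∗ L ⊆ L`. -/
def IsLeftIdeal {B : Type*} [SkewBrace B] (L : Set B) : Prop :=
  IsSubSkewBrace L ∧ ∀ b a : B, a ∈ L → sstar b a ∈ L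

/-- A strong left-ideal is a left-ideal that is normal in `(B,+)`. -/
def IsStrongLeftIdeal {B : Type*} [SkewBrace B] (L : Set B) : Prop :=
  IsLeftIdeal L ∧ ∀ b a : B, a ∈ L → b + a - b ∈ L

/-- An ideal is a strong left-ideal that is normal in `(B,·)` and satisfies
`I ∗ B ⊆ I`. -/
def IsIdeal {B : Type*} [SkewBrace B] (I : Set B) : Prop :=
  IsStrongLeftIdeal I ∧ (∀ b a : B, a ∈ I → b * a * b⁻¹ ∈ I) ∧
    ∀ a b : B, a ∈ I → sstar a b ∈ I

namespace Sylow

variable {G : Type*} [Group G] [Finite G]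

theorem normal_of_isNilpotent (h : Group.IsNilpotent G) {p : ℕ} [Fact p.Prime]
    (P : Sylow p G) : (P : Subgroup G).Normal :=
  P.normal_of_normalizerCondition Group.normalizerCondition_of_isNilpotent

theorem iSupIndep_of_isNilpotent (h : Group.IsNilpotent G)
    (P : (p : {q : ℕ // q.Prime}) → Sylow (p : ℕ) G) :
    iSupIndep fun p => (P p : Subgroup G) := by
  have hF (p : {q : ℕ // q.Prime}) : Fact (p : ℕ).Prime := ⟨p.2⟩
  have hdvd (p : {q : ℕ // q.Prime}) (hp : (P p : Subgroup G) ≠ ⊥) :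
      (p : ℕ) ∈ (Nat.card G).primeFactors := by
    refine Nat.mem_primeFactors.mpr ⟨p.2, ?_, Nat.card_pos.ne'⟩
    by_contra hn
    refine hp (Subgroup.eq_bot_of_card_eq _ ?_)
    rw [(P p).card_eq_multiplicity, Nat.factorization_eq_zero_of_not_dvd hn, pow_zero]
  have : Finite {p // (P p : Subgroup G) ≠ ⊥} :=
    Finite.of_injective
      (fun p => (⟨p.1, hdvd p.1 p.2⟩ : (Nat.card G).primeFactors))
      fun p q hpq => Subtype.ext (Subtype.ext (by simpa using hpq))
  have : ∀ p, Fintype (P p : Subgroup G) := fun p => Fintype.ofFinite _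
  have hne {p q : {q : ℕ // q.Prime}} (hpq : p ≠ q) : (p : ℕ) ≠ q :=
    fun h => hpq (Subtype.ext h)
  rw [← iSupIndep_ne_bot]
  refine Subgroup.independent_of_coprime_order ?_ ?_
  · intro p q hpq x y hx hy
    exact Subgroup.commute_of_normal_of_disjoint _ _ ((P p).normal_of_isNilpotent h)
      ((P q).normal_of_isNilpotent h)
      (IsPGroup.disjoint_of_ne _ _ (hne (Subtype.coe_injective.ne hpq)) _ _
        (P p).isPGroup' (P q).isPGroup') x y hx hy
  · intro p q hpq
    simp only [← Nat.card_eq_fintype_card]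
    exact IsPGroup.coprime_card_of_ne _ _ (hne (Subtype.coe_injective.ne hpq)) _ _
      (P p).isPGroup' (P q).isPGroup'

theorem iSup_eq_top (P : (p : {q : ℕ // q.Prime}) → Sylow (p : ℕ) G) :
    ⨆ p, (P p : Subgroup G) = ⊤ := by
  refine Subgroup.eq_top_of_card_eq _ (Nat.dvd_antisymm (Subgroup.card_subgroup_dvd_card _) ?_)
  refine (Nat.dvd_iff_prime_pow_dvd_dvd _ _).mpr fun p k hp hk => ?_
  have : Fact p.Prime := ⟨hp⟩
  exact ((P ⟨p, hp⟩).pow_dvd_card_of_pow_dvd_card hk).trans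
    (Subgroup.card_dvd_of_le (le_iSup (fun p => (P p : Subgroup G)) ⟨p, hp⟩))

end Sylow

namespace SkewBrace

variable {B : Type*} [SkewBrace B]

theorem one_eq_zero : (1 : B) = 0 := by
  have h := skew (1 : B) 0 0
  simpa using h.symm

/-- The automorphism `λ_a : b ↦ -a + a · b` of the additive group of a skew brace. -/
def lambda (a : B) : B ≃+ B where
  toFun b := -a + a * b
  invFun b := a⁻¹ * (a + b)
  left_inv b := by simp
  right_inv b := by simp
  map_add' b c := by simp [skew, sub_eq_add_neg, add_assoc]

theorem lambda_apply (a b : B) : lambda a b = -a + a * b := rfl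

theorem add_lambda (a b : B) : a + lambda a b = a * b := by simp [lambda_apply]

theorem lambda_inv (a : B) : lambda a⁻¹ a = -a⁻¹ := by
  simp [lambda_apply, one_eq_zero]

theorem neg_lambda_inv (a : B) : -lambda a⁻¹ a = a⁻¹ := by rw [lambda_inv, neg_neg]

theorem sstar_eq_lambda_sub (a b : B) : sstar a b = lambda a b - b := rfl

theorem lambda_mem {H : AddSubgroup B} [H.Characteristic] (a : B) {b : B} (hb : b ∈ H) :
    lambda a b ∈ H := by
  have h := ‹H.Characteristic›.fixed (lambda a)
  rw [← h] at hb
  exact hb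

/-- A characteristic subgroup of the additive group, as a subgroup of the multiplicative group. -/
def mulSubgroup (H : AddSubgroup B) [H.Characteristic] : Subgroup B where
  carrier := H
  one_mem' := by simp [one_eq_zero]
  mul_mem' {a b} ha hb := by
    rw [← add_lambda]
    exact H.add_mem ha (lambda_mem a hb)
  inv_mem' {a} ha := by
    rw [← neg_lambda_inv]
    exact H.neg_mem (lambda_mem a⁻¹ ha)

theorem isStrongLeftIdeal_of_characteristic (H : AddSubgroup B) [H.Characteristic] :
    IsStrongLeftIdeal (H : Set B) := by
  refine ⟨⟨⟨H.zero_mem, fun _ _ => H.add_mem, fun _ => H.neg_mem,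
    fun _ _ => (mulSubgroup H).mul_mem, fun _ => (mulSubgroup H).inv_mem⟩, fun b a ha => ?_⟩,
    fun b a ha => ?_⟩
  · rw [sstar_eq_lambda_sub]
    exact H.sub_mem (lambda_mem b ha) ha
  · rw [sub_eq_add_neg]
    exact (inferInstance : H.Normal).conj_mem a ha b

theorem isIdeal_of_characteristic (H : AddSubgroup B) [H.Characteristic]
    (hH : (mulSubgroup H).Normal) : IsIdeal (H : Set B) := by
  refine ⟨isStrongLeftIdeal_of_characteristic H, fun b a ha => hH.conj_mem a ha b,
    fun a b ha => ?_⟩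
  have hconj : b⁻¹ * a * b ∈ H := hH.conj_mem' a ha b
  have hab : sstar a b = -a + (b + lambda b (b⁻¹ * a * b) + -b) := by
    simp [add_lambda, sstar, sub_eq_add_neg, mul_assoc, add_assoc]
  rw [hab]
  exact H.add_mem (H.neg_mem ha)
    ((inferInstance : H.Normal).conj_mem _ (lambda_mem b hconj) b)

theorem characteristic_toAddSubgroup' {A : Type*} [AddGroup A] (H : Subgroup (Multiplicative A))
    [H.Characteristic] : (Subgroup.toAddSubgroup' H).Characteristic :=
  ⟨fun f => by
    have h := ‹H.Characteristic›.fixed (AddEquiv.toMultiplicative f)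
    exact congrArg Subgroup.toAddSubgroup' h⟩

end SkewBrace

/-- Let `B` be a finite skew brace whose additive and multiplicative groups are
both nilpotent.  Then for each prime `p` the (unique) Sylow `p`-subgroup of
`(B,+)` is also a Sylow `p`-subgroup of `(B,·)` and is an ideal of `B`, and
`B` is the (internal) direct product of its Sylow subbraces, both additively
and multiplicatively. -/
theorem statement14 (B : Type*) [SkewBrace B] [Fintype B]
    (hnilAdd : Group.IsNilpotent (Multiplicative B))
    (hnilMul : Group.IsNilpotent B) :
    (∀ (p : ℕ), p.Prime → ∀ P : Sylow p (Multiplicative B),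
      IsIdeal ((Subgroup.toAddSubgroup' (P : Subgroup (Multiplicative B)) :
          AddSubgroup B) : Set B) ∧
      ∃ Q : Sylow p B, ((Q : Subgroup B) : Set B) =
        ((Subgroup.toAddSubgroup' (P : Subgroup (Multiplicative B)) :
          AddSubgroup B) : Set B)) ∧
    (∀ P : (p : {q : ℕ // q.Prime}) → Sylow (p : ℕ) (Multiplicative B),
      iSupIndep (fun p : {q : ℕ // q.Prime} =>
        (Subgroup.toAddSubgroup' ((P p : Subgroup (Multiplicative B))) :
          AddSubgroup B)) ∧
      (⨆ p : {q : ℕ // q.Prime},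
        (Subgroup.toAddSubgroup' ((P p : Subgroup (Multiplicative B))) :
          AddSubgroup B)) = ⊤) ∧
    (∀ Q : (p : {q : ℕ // q.Prime}) → Sylow (p : ℕ) B,
      iSupIndep (fun p : {q : ℕ // q.Prime} => (Q p : Subgroup B)) ∧
      (⨆ p : {q : ℕ // q.Prime}, (Q p : Subgroup B)) = ⊤) := by
  refine ⟨fun p hp P => ?_, fun P => ⟨?_, ?_⟩,
    fun Q => ⟨Sylow.iSupIndep_of_isNilpotent hnilMul Q, Sylow.iSup_eq_top Q⟩⟩
  · have : Fact p.Prime := ⟨hp⟩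
    have : (P : Subgroup (Multiplicative B)).Characteristic :=
      P.characteristic_of_normal (P.normal_of_isNilpotent hnilAdd)
    have := SkewBrace.characteristic_toAddSubgroup' (P : Subgroup (Multiplicative B))
    let Q : Sylow p B := Sylow.ofCard
      (SkewBrace.mulSubgroup (Subgroup.toAddSubgroup' (P : Subgroup (Multiplicative B))))
      P.card_eq_multiplicity
    exact ⟨SkewBrace.isIdeal_of_characteristic _ (Q.normal_of_isNilpotent hnilMul), Q, rfl⟩
  · exact (Sylow.iSupIndep_of_isNilpotent hnilAdd P).map_orderIso Subgroup.toAddSubgroup'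
  · rw [← OrderIso.map_iSup, Sylow.iSup_eq_top P, OrderIso.map_top]
end

section
/- There exists a brace B of order 32, with additive group elementary abelian of order 2^5, such that (b∗b)∗b = 0 and b∗(b∗b) = 0 for all b ∈ B, b∗b ≠ 0 for some b ∈ B, the homomorphism λ has trivial kernel (so Soc(B) = {0}), and B is not right-nilpotent. -/
/-- `B` is a brace of order `32` with additive group elementary abelian of
order `2^5`, `(b∗b)∗b = 0 = b∗(b∗b)` for all `b`, `b∗b ≠ 0` for some `b`, the
homomorphism `λ` (given by `λ_a(b) = -a + a·b`) has trivial kernel, so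
`Soc(B) = Ker λ ∩ Z(B,+) = {0}`, and `B` is not right-nilpotent. -/
def Statement16Prop (B : Type*) [SkewBrace B] [Fintype B] : Prop :=
  Fintype.card B = 32 ∧
  (∀ a b : B, a + b = b + a) ∧
  Nonempty (B ≃+ (Fin 5 → ZMod 2)) ∧
  (∀ b : B, sstar (sstar b b) b = 0 ∧ sstar b (sstar b b) = 0) ∧
  (∃ b : B, sstar b b ≠ 0) ∧
  (∀ a : B, (∀ b : B, sstar a b = 0) → a = 0) ∧
  {a : B | (∀ b : B, sstar a b = 0) ∧ ∀ b : B, a + b = b + a} = {(0 : B)} ∧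
  ¬ RightNilpotent B

/-- If the kernel of `λ` is trivial, then `X ∗ B = {0}` forces `X ⊆ {0}`. -/
theorem eq_zero_of_starClosure_eq_zero {B : Type*} [SkewBrace B]
    (hker : ∀ a : B, (∀ b : B, sstar a b = 0) → a = 0) {X : Set B}
    (hX : (starClosure X Set.univ : Set B) = {0}) {x : B} (hx : x ∈ X) : x = 0 := by
  refine hker x fun b => ?_
  have h : sstar x b ∈ (starClosure X Set.univ : Set B) :=
    AddSubgroup.subset_closure ⟨x, hx, b, Set.mem_univ b, rfl⟩
  rwa [hX] at h

/-- A nontrivial skew brace whose `λ`-map is injective is not right-nilpotent. -/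
theorem not_rightNilpotent_of_ker_trivial {B : Type*} [SkewBrace B] [Nontrivial B]
    (hker : ∀ a : B, (∀ b : B, sstar a b = 0) → a = 0) : ¬ RightNilpotent B := by
  rintro ⟨n, hn⟩
  have hzero : ∀ x ∈ rightSeries B 0, x = 0 := by
    replace hn : ∀ x ∈ rightSeries B n, x = 0 := fun x hx => by rwa [hn] at hx
    induction n with
    | zero => exact hn
    | succ n ih =>
      refine ih fun x hx => eq_zero_of_starClosure_eq_zero hker ?_ hx
      exact Set.eq_singleton_iff_unique_mem.2 ⟨AddSubgroup.zero_mem _, hn⟩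
  obtain ⟨x, hx⟩ := exists_ne (0 : B)
  exact hx (hzero x (Set.mem_univ x))

/-- The underlying set `𝔽₂⁵` of the brace of order `32`. -/
def F2Brace : Type := Fin 5 → ZMod 2

namespace F2Brace

instance : AddCommGroup F2Brace := inferInstanceAs (AddCommGroup (Fin 5 → ZMod 2))

instance : Fintype F2Brace := inferInstanceAs (Fintype (Fin 5 → ZMod 2))

instance : Nontrivial F2Brace := inferInstanceAs (Nontrivial (Fin 5 → ZMod 2))

/-- The vector with the given coordinates. -/
def mk (x₀ x₁ x₂ x₃ x₄ : ZMod 2) : F2Brace := ![x₀, x₁, x₂, x₃, x₄]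

theorem exists_mk (a : F2Brace) : ∃ x₀ x₁ x₂ x₃ x₄, a = mk x₀ x₁ x₂ x₃ x₄ :=
  ⟨a 0, a 1, a 2, a 3, a 4, by funext i; fin_cases i <;> rfl⟩

theorem mk_inj {x₀ x₁ x₂ x₃ x₄ y₀ y₁ y₂ y₃ y₄ : ZMod 2} :
    mk x₀ x₁ x₂ x₃ x₄ = mk y₀ y₁ y₂ y₃ y₄ ↔
      x₀ = y₀ ∧ x₁ = y₁ ∧ x₂ = y₂ ∧ x₃ = y₃ ∧ x₄ = y₄ :=
  ⟨fun h => ⟨congrFun h 0, congrFun h 1, congrFun h 2, congrFun h 3, congrFun h 4⟩,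
    by rintro ⟨rfl, rfl, rfl, rfl, rfl⟩; rfl⟩

theorem zero_eq_mk : (0 : F2Brace) = mk 0 0 0 0 0 := by
  funext i; fin_cases i <;> rfl

theorem mk_add_mk (x₀ x₁ x₂ x₃ x₄ y₀ y₁ y₂ y₃ y₄ : ZMod 2) :
    mk x₀ x₁ x₂ x₃ x₄ + mk y₀ y₁ y₂ y₃ y₄ =
      mk (x₀ + y₀) (x₁ + y₁) (x₂ + y₂) (x₃ + y₃) (x₄ + y₄) := by
  funext i; fin_cases i <;> rfl

/-- The quadratic form `q(a) = a₀ + a₁a₃ + a₂a₄`; it is a homomorphism from the multiplicative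
group to `𝔽₂`. -/
def quad (a : F2Brace) : ZMod 2 := a 0 + a 1 * a 3 + a 2 * a 4

/-- The linear map `λ_a`. -/
def lam (a b : F2Brace) : F2Brace :=
  mk (b 0 + a 3 * b 1 + a 4 * b 2 + (a 1 + a 4 * quad a) * b 3 + (a 2 + a 3 * quad a) * b 4)
    (b 1 + quad a * b 4) (b 2 + quad a * b 3) (b 3) (b 4)

theorem quad_mk (x₀ x₁ x₂ x₃ x₄ : ZMod 2) :
    quad (mk x₀ x₁ x₂ x₃ x₄) = x₀ + x₁ * x₃ + x₂ * x₄ := rfl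

theorem lam_mk (x₀ x₁ x₂ x₃ x₄ y₀ y₁ y₂ y₃ y₄ : ZMod 2) :
    lam (mk x₀ x₁ x₂ x₃ x₄) (mk y₀ y₁ y₂ y₃ y₄) =
      mk (y₀ + x₃ * y₁ + x₄ * y₂ + (x₁ + x₄ * (x₀ + x₁ * x₃ + x₂ * x₄)) * y₃ +
          (x₂ + x₃ * (x₀ + x₁ * x₃ + x₂ * x₄)) * y₄)
        (y₁ + (x₀ + x₁ * x₃ + x₂ * x₄) * y₄) (y₂ + (x₀ + x₁ * x₃ + x₂ * x₄) * y₃) y₃ y₄ := rfl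

theorem lam_add (a b c : F2Brace) : lam a (b + c) = lam a b + lam a c := by
  obtain ⟨a₀, a₁, a₂, a₃, a₄, rfl⟩ := exists_mk a
  obtain ⟨b₀, b₁, b₂, b₃, b₄, rfl⟩ := exists_mk b
  obtain ⟨c₀, c₁, c₂, c₃, c₄, rfl⟩ := exists_mk c
  simp only [mk_add_mk, lam_mk, mk_inj, and_true]
  refine ⟨?_, ?_, ?_⟩ <;> ring

theorem quad_add_lam (a b : F2Brace) : quad (a + lam a b) = quad a + quad b := by
  obtain ⟨a₀, a₁, a₂, a₃, a₄, rfl⟩ := exists_mk a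
  obtain ⟨b₀, b₁, b₂, b₃, b₄, rfl⟩ := exists_mk b
  simp only [mk_add_mk, lam_mk, quad_mk]
  grind

theorem lam_add_lam (a b c : F2Brace) : lam (a + lam a b) c = lam a (lam b c) := by
  have hq := quad_add_lam a b
  obtain ⟨a₀, a₁, a₂, a₃, a₄, rfl⟩ := exists_mk a
  obtain ⟨b₀, b₁, b₂, b₃, b₄, rfl⟩ := exists_mk b
  obtain ⟨c₀, c₁, c₂, c₃, c₄, rfl⟩ := exists_mk c
  simp only [mk_add_mk, lam_mk, quad_mk] at hq
  simp only [mk_add_mk, lam_mk, mk_inj, hq, and_true]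
  refine ⟨?_, ?_, ?_⟩ <;> grind

theorem lam_zero_left (a : F2Brace) : lam 0 a = a := by
  obtain ⟨a₀, a₁, a₂, a₃, a₄, rfl⟩ := exists_mk a
  simp [zero_eq_mk, lam_mk]

theorem lam_zero_right (a : F2Brace) : lam a 0 = 0 := by
  obtain ⟨a₀, a₁, a₂, a₃, a₄, rfl⟩ := exists_mk a
  simp [zero_eq_mk, lam_mk]

/-- The multiplicative inverse. -/
def mulInv (a : F2Brace) : F2Brace :=
  mk (a 0) (a 1 + quad a * a 4) (a 2 + quad a * a 3) (a 3) (a 4)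

theorem mulInv_add_lam (a : F2Brace) : mulInv a + lam (mulInv a) a = 0 := by
  obtain ⟨a₀, a₁, a₂, a₃, a₄, rfl⟩ := exists_mk a
  have h : mulInv (mk a₀ a₁ a₂ a₃ a₄) =
    mk a₀ (a₁ + (a₀ + a₁ * a₃ + a₂ * a₄) * a₄) (a₂ + (a₀ + a₁ * a₃ + a₂ * a₄) * a₃) a₃ a₄ := rfl
  rw [h]
  simp only [zero_eq_mk, mk_add_mk, lam_mk, mk_inj]
  refine ⟨?_, ?_, ?_, ?_, ?_⟩ <;> grind

instance : Group F2Brace where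
  mul a b := a + lam a b
  one := 0
  inv := mulInv
  mul_assoc a b c := by
    change a + lam a b + lam (a + lam a b) c = a + lam a (b + lam b c)
    rw [lam_add_lam, lam_add, add_assoc]
  one_mul a := by
    change 0 + lam 0 a = a
    rw [lam_zero_left, zero_add]
  mul_one a := by
    change a + lam a 0 = a
    rw [lam_zero_right, add_zero]
  inv_mul_cancel := mulInv_add_lam

theorem mul_eq_add_lam (a b : F2Brace) : a * b = a + lam a b := rfl

instance : SkewBrace F2Brace where
  skew a b c := by
    simp only [mul_eq_add_lam, lam_add]
    abel

theorem sstar_eq (a b : F2Brace) : sstar a b = lam a b - b := by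
  change -a + (a + lam a b) - b = _
  abel

theorem sstar_eq_zero_iff {a b : F2Brace} : sstar a b = 0 ↔ lam a b = b := by
  rw [sstar_eq, sub_eq_zero]

theorem sstar_self_mk (x₀ x₁ x₂ x₃ x₄ : ZMod 2) :
    sstar (mk x₀ x₁ x₂ x₃ x₄) (mk x₀ x₁ x₂ x₃ x₄) =
      mk 0 ((x₀ + x₁ * x₃ + x₂ * x₄) * x₄) ((x₀ + x₁ * x₃ + x₂ * x₄) * x₃) 0 0 := by
  rw [sstar_eq, sub_eq_iff_eq_add]
  simp only [mk_add_mk, lam_mk, mk_inj]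
  refine ⟨?_, ?_, ?_, ?_, ?_⟩ <;> grind

theorem sstar_sstar_self (b : F2Brace) : sstar (sstar b b) b = 0 := by
  obtain ⟨x₀, x₁, x₂, x₃, x₄, rfl⟩ := exists_mk b
  rw [sstar_self_mk, sstar_eq_zero_iff]
  simp only [lam_mk, mk_inj, and_true]
  refine ⟨?_, ?_, ?_⟩ <;> grind

theorem sstar_self_sstar (b : F2Brace) : sstar b (sstar b b) = 0 := by
  obtain ⟨x₀, x₁, x₂, x₃, x₄, rfl⟩ := exists_mk b
  rw [sstar_self_mk, sstar_eq_zero_iff]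
  simp only [lam_mk, mk_inj, and_true]
  refine ⟨?_, ?_, ?_⟩ <;> grind

theorem exists_sstar_self_ne_zero : ∃ b : F2Brace, sstar b b ≠ 0 := by
  refine ⟨mk 1 0 0 1 0, ?_⟩
  rw [sstar_self_mk, zero_eq_mk, Ne, mk_inj]
  decide

theorem eq_zero_of_sstar_eq_zero (a : F2Brace) (h : ∀ b, sstar a b = 0) : a = 0 := by
  simp only [sstar_eq_zero_iff] at h
  obtain ⟨x₀, x₁, x₂, x₃, x₄, rfl⟩ := exists_mk a
  have h₁ := h (mk 0 1 0 0 0)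
  have h₂ := h (mk 0 0 1 0 0)
  have h₃ := h (mk 0 0 0 1 0)
  have h₄ := h (mk 0 0 0 0 1)
  simp only [lam_mk, mk_inj] at h₁ h₂ h₃ h₄
  rw [zero_eq_mk, mk_inj]
  refine ⟨?_, ?_, ?_, ?_, ?_⟩ <;> grind

end F2Brace

/-- There exists a brace of order `32`, with elementary abelian additive group
of order `2^5`, in which `(b∗b)∗b = 0` and `b∗(b∗b) = 0` for all `b` but
`b∗b ≠ 0` for some `b`, whose `λ`-map has trivial kernel (so `Soc(B) = {0}`),
and which is not right-nilpotent. -/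
theorem statement16 :
    ∃ (B : Type) (inst : SkewBrace B) (instF : Fintype B),
      @Statement16Prop B inst instF := by
  refine ⟨F2Brace, inferInstance, inferInstance, ?_, fun a b => add_comm a b,
    ⟨AddEquiv.refl (Fin 5 → ZMod 2)⟩,
    fun b => ⟨F2Brace.sstar_sstar_self b, F2Brace.sstar_self_sstar b⟩,
    F2Brace.exists_sstar_self_ne_zero, F2Brace.eq_zero_of_sstar_eq_zero, ?_,
    not_rightNilpotent_of_ker_trivial F2Brace.eq_zero_of_sstar_eq_zero⟩
  · change Fintype.card (Fin 5 → ZMod 2) = 32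
    simp [ZMod.card]
  · refine Set.eq_singleton_iff_unique_mem.2
      ⟨⟨fun b => F2Brace.sstar_eq_zero_iff.2 (F2Brace.lam_zero_left b), fun b => add_comm 0 b⟩,
        fun a ha => F2Brace.eq_zero_of_sstar_eq_zero a ha.1⟩
end

section
/- There exists a finite brace B that is right-nil (indeed (b∗b)∗b = 0 for every b ∈ B) but not right-nilpotent. In particular, a finite right-nil skew brace need not be right-nilpotent (negative answer to Question 2.34 of Cedó–Smoktunowicz–Vendramin). -/
/-- The left-normed iterated star product of copies of `b`:
`rIter b n = ((…((b ∗ b) ∗ b)…) ∗ b)` with `n + 1` occurrences of `b`. -/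
def rIter {B : Type*} [SkewBrace B] (b : B) : ℕ → B
  | 0 => b
  | n + 1 => sstar (rIter b n) b

/-- A skew brace is right-nil if for every `b` some left-normed iterated star
product of copies of `b` vanishes. -/
def RightNil (B : Type*) [SkewBrace B] : Prop :=
  ∀ b : B, ∃ m : ℕ, rIter b m = 0

/-- `B` is a finite brace that is right-nil — indeed `(b∗b)∗b = 0` for every
`b` — but not right-nilpotent. -/
def Statement17Prop (B : Type*) [SkewBrace B] [Fintype B] : Prop :=
  (∀ a b : B, a + b = b + a) ∧
  RightNil B ∧
  (∀ b : B, sstar (sstar b b) b = 0) ∧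
  ¬ RightNilpotent B

/-- The skew brace on an abelian group `A` determined by endomorphisms `lam a` satisfying
`lam (a + lam a b) = lam a ∘ lam b`, with product `a · b = a + lam a b`. -/
abbrev SkewBrace.ofLambda {A : Type*} [AddCommGroup A] (lam : A → A →+ A) (inv : A → A)
    (lam_zero : ∀ b, lam 0 b = b)
    (lam_mul : ∀ a b c, lam (a + lam a b) c = lam a (lam b c))
    (lam_inv : ∀ a, inv a + lam (inv a) a = 0) : SkewBrace A :=
  letI : Mul A := ⟨fun a b => a + lam a b⟩
  letI : One A := ⟨0⟩
  letI : Inv A := ⟨inv⟩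
  { toAddGroup := inferInstance
    toGroup := Group.ofLeftAxioms
      (fun a b c => by
        change a + lam a b + lam (a + lam a b) c = a + lam a (b + lam b c)
        rw [lam_mul, map_add, add_assoc])
      (fun a => by
        change 0 + lam 0 a = a
        rw [zero_add, lam_zero])
      lam_inv
    skew := fun a b c => by
      change a + lam a (b + c) = a + lam a b - a + (a + lam a c)
      rw [map_add]
      abel }

namespace HyperbolicBrace

/-- The hyperbolic quadratic space of dimension four over the field with two elements. -/
abbrev V : Type := (ZMod 2 × ZMod 2) × (ZMod 2 × ZMod 2)

/-- The hyperbolic quadratic form. -/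
def quad (x : V) : ZMod 2 := x.1.1 * x.2.1 + x.1.2 * x.2.2

/-- The polar form of `quad`. -/
def polar (x y : V) : ZMod 2 :=
  x.1.1 * y.2.1 + x.2.1 * y.1.1 + x.1.2 * y.2.2 + x.2.2 * y.1.2

/-- The power with exponent `t` of the isometry swapping the coordinates in both factors. -/
def act (t : ZMod 2) (x : V) : V := if t = 0 then x else (x.1.swap, x.2.swap)

lemma act_zero (x : V) : act 0 x = x := rfl

lemma act_add (t : ZMod 2) (x y : V) : act t (x + y) = act t x + act t y := by
  unfold act; split <;> rfl

lemma act_act (t s : ZMod 2) (x : V) : act t (act s x) = act (t + s) x := by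
  revert t s x; decide

lemma quad_act (t : ZMod 2) (x : V) : quad (act t x) = quad x := by
  revert t x; decide

lemma quad_add (x y : V) : quad (x + y) = quad x + quad y + polar x y := by
  simp only [quad, polar, Prod.fst_add, Prod.snd_add]; ring

lemma polar_add_left (x y z : V) : polar (x + y) z = polar x z + polar y z := by
  simp only [polar, Prod.fst_add, Prod.snd_add]; ring

lemma polar_add_right (x y z : V) : polar x (y + z) = polar x y + polar x z := by
  simp only [polar, Prod.fst_add, Prod.snd_add]; ring

lemma polar_act (t : ZMod 2) (x y : V) : polar (act t x) (act t y) = polar x y := by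
  unfold act polar
  split
  · rfl
  · simp only [Prod.fst_swap, Prod.snd_swap]; ring

lemma polar_zero_left (x : V) : polar 0 x = 0 := by simp [polar]

/-- The exponent by which an element of the brace acts on `V`. -/
def expo (a : V × ZMod 2) : ZMod 2 := a.2 + quad a.1

/-- The lambda map of the brace. -/
def lam (a : V × ZMod 2) : V × ZMod 2 →+ V × ZMod 2 where
  toFun b := (act (expo a) b.1, b.2 + polar a.1 (act (expo a) b.1))
  map_zero' := by
    have h : act (expo a) 0 = 0 := by unfold act; split <;> rfl
    simp [h, polar]
  map_add' b c := by
    ext1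
    · exact act_add _ _ _
    · simp only [Prod.fst_add, Prod.snd_add, act_add, polar_add_right]; ring

lemma lam_apply (a b : V × ZMod 2) :
    lam a b = (act (expo a) b.1, b.2 + polar a.1 (act (expo a) b.1)) := rfl

lemma expo_add_lam (a b : V × ZMod 2) : expo (a + lam a b) = expo a + expo b := by
  simp only [expo, lam_apply, Prod.fst_add, Prod.snd_add, quad_add, quad_act]
  linear_combination CharTwo.add_self_eq_zero (polar a.1 (act (a.2 + quad a.1) b.1))

lemma lam_add_lam (a b c : V × ZMod 2) : lam (a + lam a b) c = lam a (lam b c) := by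
  rw [lam_apply (a + lam a b), expo_add_lam]
  simp only [lam_apply, Prod.fst_add, polar_add_left, ← act_act, polar_act]
  ext1
  · rfl
  · ring

/-- The inverse for the product of the brace. -/
def inv (a : V × ZMod 2) : V × ZMod 2 := (act (expo a) a.1, a.2)

lemma inv_add_lam (a : V × ZMod 2) : inv a + lam (inv a) a = 0 := by
  revert a; decide

/-- The brace on `V × ZMod 2`. -/
abbrev brace : SkewBrace (V × ZMod 2) :=
  SkewBrace.ofLambda lam inv
    (fun b => by simp [lam_apply, expo, quad, act_zero, polar_zero_left])
    lam_add_lam inv_add_lam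

lemma sstar_eq (a b : V × ZMod 2) : @sstar _ brace a b = lam a b - b := by
  change -a + (a + lam a b) - b = _
  rw [neg_add_cancel_left]

lemma sstar_sstar_self (b : V × ZMod 2) : @sstar _ brace (@sstar _ brace b b) b = 0 := by
  simp only [sstar_eq]
  revert b; decide

lemma mem_rightSeries (n : ℕ) :
    (((0, 0), (0, 0)), 1) ∈ @rightSeries (V × ZMod 2) brace n ∧
      (((1, 1), (0, 0)), 0) ∈ @rightSeries (V × ZMod 2) brace n := by
  let := brace
  induction n with
  | zero => exact ⟨trivial, trivial⟩
  | succ n ih =>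
    refine ⟨AddSubgroup.subset_closure ⟨_, ih.2, (((0, 0), (1, 0)), 0), trivial, ?_⟩,
      AddSubgroup.subset_closure ⟨_, ih.1, (((1, 0), (0, 0)), 0), trivial, ?_⟩⟩
    · rw [sstar_eq]; decide
    · rw [sstar_eq]; decide

lemma not_rightNilpotent : ¬ @RightNilpotent (V × ZMod 2) brace := by
  rintro ⟨n, hn⟩
  have h := (mem_rightSeries n).1
  rw [hn] at h
  have h1 : ((((0, 0), (0, 0)), 1) : V × ZMod 2) = 0 := h
  exact absurd h1 (by decide)

end HyperbolicBrace

/-- There exists a finite brace that is right-nil (indeed `(b∗b)∗b = 0` for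
every `b`) but not right-nilpotent: a finite right-nil skew brace need not be
right-nilpotent. -/
theorem statement17 :
    ∃ (B : Type) (inst : SkewBrace B) (instF : Fintype B),
      @Statement17Prop B inst instF :=
  ⟨HyperbolicBrace.V × ZMod 2, HyperbolicBrace.brace, inferInstance,
    fun a b => add_comm (G := HyperbolicBrace.V × ZMod 2) a b,
    fun b => ⟨2, HyperbolicBrace.sstar_sstar_self b⟩,
    HyperbolicBrace.sstar_sstar_self, HyperbolicBrace.not_rightNilpotent⟩
end
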